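/- Let λ > 0 and let γ : ℝ → ℝ² be a unit-speed self-expanding plane curve with curvature function k. Then the function f(t) := ‖γ(t)‖²/2 is twice differentiable with f''(t) = 1 + k(t)²/λ ≥ 1 for all t; consequently ‖γ(t)‖ → ∞ as t → +∞ and as t → −∞. -/

import Mathlib

open scoped RealInnerProductSpace

/-- The leftward unit normal `ν(t) = (−γ′₂(t), γ′₁(t))` of a unit-speed plane
curve `γ`, obtained by rotating `γ′(t)` counterclockwise by `π/2`. -/
noncomputable def expNormal (γ : ℝ → EuclideanSpace ℝ (Fin 2)) (t : ℝ) :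
    EuclideanSpace ℝ (Fin 2) :=
  (WithLp.equiv 2 (Fin 2 → ℝ)).symm ![-(deriv γ t 1), deriv γ t 0]

/-- The curvature function `k(t) = ⟨γ″(t), ν(t)⟩` of a unit-speed plane curve. -/
noncomputable def curvatureFn (γ : ℝ → EuclideanSpace ℝ (Fin 2)) (t : ℝ) : ℝ :=
  ⟪deriv (deriv γ) t, expNormal γ t⟫

/-- A unit-speed self-expanding plane curve with constant `lam`: a `C²` curve
`γ : ℝ → ℝ²` with `‖γ′(t)‖ = 1` for all `t`, whose curvature satisfies
`k(t) = lam * ⟨γ(t), ν(t)⟩` for all `t`. -/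
def IsSelfExpandingCurve (lam : ℝ) (γ : ℝ → EuclideanSpace ℝ (Fin 2)) : Prop :=
  ContDiff ℝ 2 γ ∧ (∀ t, ‖deriv γ t‖ = 1) ∧
    ∀ t, curvatureFn γ t = lam * ⟪γ t, expNormal γ t⟫

section SelfExpanding

variable {lam : ℝ} {γ : ℝ → EuclideanSpace ℝ (Fin 2)}

theorem inner_expNormal (v : EuclideanSpace ℝ (Fin 2)) (t : ℝ) :
    ⟪v, expNormal γ t⟫ = v 1 * deriv γ t 0 - v 0 * deriv γ t 1 := by
  simp [expNormal, PiLp.inner_apply, Fin.sum_univ_two]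
  ring

theorem deriv_half_norm_sq (h : Differentiable ℝ γ) :
    (deriv fun s : ℝ => ‖γ s‖ ^ 2 / 2) = fun t => ⟪γ t, deriv γ t⟫ := by
  funext t
  have := ((h t).hasDerivAt.norm_sq.div_const 2).deriv
  simpa using this

/-- The derivative of a differentiable unit field is orthogonal to it. -/
theorem inner_deriv_eq_zero_of_norm_eq_one {E : Type*} [NormedAddCommGroup E]
    [InnerProductSpace ℝ E] {u : ℝ → E} (hu : Differentiable ℝ u) (h : ∀ t, ‖u t‖ = 1) (t : ℝ) :
    ⟪u t, deriv u t⟫ = 0 := by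
  have h₁ := (hu t).hasDerivAt.norm_sq
  simp only [h] at h₁
  have h₂ := h₁.unique (hasDerivAt_const t _)
  linarith

namespace IsSelfExpandingCurve

theorem differentiable (hγ : IsSelfExpandingCurve lam γ) : Differentiable ℝ γ :=
  hγ.1.differentiable (by norm_num)

theorem differentiable_deriv (hγ : IsSelfExpandingCurve lam γ) : Differentiable ℝ (deriv γ) :=
  (contDiff_succ_iff_deriv (n := 1).1 hγ.1).2.2.differentiable (by norm_num)

theorem inner_deriv_deriv (hγ : IsSelfExpandingCurve lam γ) (hlam : lam ≠ 0) (t : ℝ) :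
    ⟪γ t, deriv (deriv γ) t⟫ = curvatureFn γ t ^ 2 / lam := by
  have horth := inner_deriv_eq_zero_of_norm_eq_one hγ.differentiable_deriv hγ.2.1 t
  have hunit : ⟪deriv γ t, deriv γ t⟫ = 1 := by
    rw [real_inner_self_eq_norm_sq, hγ.2.1 t, one_pow]
  have hk := hγ.2.2 t
  have hk' : curvatureFn γ t = ⟪deriv (deriv γ) t, expNormal γ t⟫ := rfl
  rw [inner_expNormal] at hk hk'
  simp only [PiLp.inner_apply, Fin.sum_univ_two, RCLike.inner_apply, conj_trivial] at horth hunit ⊢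
  set k := curvatureFn γ t
  have hb₀ : deriv (deriv γ) t 0 = -k * deriv γ t 1 := by
    linear_combination deriv γ t 1 * hk' - deriv (deriv γ) t 0 * hunit + deriv γ t 0 * horth
  have hb₁ : deriv (deriv γ) t 1 = k * deriv γ t 0 := by
    linear_combination -deriv γ t 0 * hk' - deriv (deriv γ) t 1 * hunit + deriv γ t 1 * horth
  rw [eq_div_iff hlam, hb₀, hb₁]
  linear_combination -k * hk

theorem hasDerivAt_inner_deriv (hγ : IsSelfExpandingCurve lam γ) (hlam : lam ≠ 0) (t : ℝ) :
    HasDerivAt (fun s => ⟪γ s, deriv γ s⟫) (1 + curvatureFn γ t ^ 2 / lam) t := by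
  refine ((hγ.differentiable t).hasDerivAt.inner ℝ
    (hγ.differentiable_deriv t).hasDerivAt).congr_deriv ?_
  rw [hγ.inner_deriv_deriv hlam, real_inner_self_eq_norm_sq, hγ.2.1 t]
  ring

theorem monotone_inner_deriv_sub_id (hγ : IsSelfExpandingCurve lam γ) (hlam : 0 < lam) :
    Monotone fun t => ⟪γ t, deriv γ t⟫ - t := by
  have h t := (hγ.hasDerivAt_inner_deriv hlam.ne' t).sub (hasDerivAt_id t)
  refine monotone_of_hasDerivAt_nonneg h fun t => ?_
  have : 0 ≤ curvatureFn γ t ^ 2 / lam := by positivity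
  simpa using this

theorem abs_inner_deriv_le (hγ : IsSelfExpandingCurve lam γ) (t : ℝ) :
    |⟪γ t, deriv γ t⟫| ≤ ‖γ t‖ := by
  simpa [hγ.2.1 t] using abs_real_inner_le_norm (γ t) (deriv γ t)

theorem tendsto_norm_atTop (hγ : IsSelfExpandingCurve lam γ) (hlam : 0 < lam) :
    Filter.Tendsto (fun t => ‖γ t‖) Filter.atTop Filter.atTop := by
  refine Filter.tendsto_atTop_mono' _ ?_
    (Filter.tendsto_atTop_add_const_left _ ⟪γ 0, deriv γ 0⟫ Filter.tendsto_id)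
  filter_upwards [Filter.eventually_ge_atTop 0] with t ht
  have h₁ := hγ.monotone_inner_deriv_sub_id hlam ht
  have h₂ := (le_abs_self _).trans (hγ.abs_inner_deriv_le t)
  simp only [id] at h₁ ⊢
  linarith

theorem tendsto_norm_atBot (hγ : IsSelfExpandingCurve lam γ) (hlam : 0 < lam) :
    Filter.Tendsto (fun t => ‖γ t‖) Filter.atBot Filter.atTop := by
  refine Filter.tendsto_atTop_mono' _ ?_
    (Filter.tendsto_atTop_add_const_left _ (-⟪γ 0, deriv γ 0⟫) Filter.tendsto_neg_atBot_atTop)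
  filter_upwards [Filter.eventually_le_atBot 0] with t ht
  have h₁ := hγ.monotone_inner_deriv_sub_id hlam ht
  have h₂ := (neg_le_abs _).trans (hγ.abs_inner_deriv_le t)
  simp only at h₁ ⊢
  linarith

end IsSelfExpandingCurve

end SelfExpanding

/-- For a unit-speed self-expanding plane curve,
`f(t) := ‖γ(t)‖²/2` is twice differentiable with `f″(t) = 1 + k(t)²/lam ≥ 1`;
consequently `‖γ(t)‖ → ∞` as `t → ±∞`. -/
theorem sq_dist_convex_and_proper
    (lam : ℝ) (hlam : 0 < lam) (γ : ℝ → EuclideanSpace ℝ (Fin 2))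
    (hγ : IsSelfExpandingCurve lam γ) :
    (∀ t : ℝ, HasDerivAt (deriv fun s : ℝ => ‖γ s‖ ^ 2 / 2)
        (1 + curvatureFn γ t ^ 2 / lam) t) ∧
      (∀ t : ℝ, 1 ≤ 1 + curvatureFn γ t ^ 2 / lam) ∧
      Filter.Tendsto (fun t : ℝ => ‖γ t‖) Filter.atTop Filter.atTop ∧
      Filter.Tendsto (fun t : ℝ => ‖γ t‖) Filter.atBot Filter.atTop := by
  refine ⟨fun t => ?_, fun t => ?_, hγ.tendsto_norm_atTop hlam, hγ.tendsto_norm_atBot hlam⟩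
  · rw [deriv_half_norm_sq hγ.differentiable]
    exact hγ.hasDerivAt_inner_deriv hlam.ne' t
  · have : 0 ≤ curvatureFn γ t ^ 2 / lam := by positivity
    linarith
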